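/- arXiv:1812.11157 — 5 statements merged into one kernel-verified Lean document; each statement's English description precedes it below -/
import Mathlib

section
/- The class of all finite graphs has EPPA (Hrushovski's theorem): for every finite graph G there exists a finite graph H containing G as an induced subgraph such that every isomorphism between induced subgraphs of G extends to an automorphism of H. -/
/-- A partial injective function on `V`, represented by its graph `p ⊆ V × V`. -/
def IsPartialFun {V : Type} (p : Set (V × V)) : Prop :=
  ∀ u ∈ p, ∀ v ∈ p, (u.1 = v.1 ↔ u.2 = v.2)

/-- A graph on pairs `(x, χ)` with `χ : V → Bool`: two pairs over distinct vertices are adjacent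
when their valuations disagree. -/
def valuationGraph (V : Type*) : SimpleGraph (V × (V → Bool)) where
  Adj a b := a.1 ≠ b.1 ∧ a.2 b.1 ≠ b.2 a.1
  symm := ⟨fun _ _ h => ⟨h.1.symm, h.2.symm⟩⟩
  loopless := ⟨fun _ h => h.1 rfl⟩

/-- Permute the vertices by `π` and flip the valuations according to `F`. -/
def valuationPerm {V : Type*} (π : Equiv.Perm V) (F : V → V → Bool) :
    Equiv.Perm (V × (V → Bool)) where
  toFun a := (π a.1, fun z => (a.2 (π.symm z)).xor (F a.1 (π.symm z)))
  invFun a := (π.symm a.1, fun y => (a.2 (π y)).xor (F (π.symm a.1) y))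
  left_inv a := by simp
  right_inv a := by simp

theorem valuationGraph_adj_valuationPerm {V : Type*} (π : Equiv.Perm V) {F : V → V → Bool}
    (hF : ∀ x y, x ≠ y → F x y = F y x) (a b : V × (V → Bool)) :
    (valuationGraph V).Adj (valuationPerm π F a) (valuationPerm π F b) ↔
      (valuationGraph V).Adj a b := by
  simp only [valuationGraph, valuationPerm, Equiv.coe_fn_mk, ne_eq, EmbeddingLike.apply_eq_iff_eq,
    Equiv.symm_apply_apply]
  refine and_congr_right fun h => ?_
  rw [hF _ _ h, Bool.xor_left_inj]

/-- Valuations of the vertices of `G` whose pairwise disagreements are exactly the edges. -/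
theorem SimpleGraph.exists_valuation {V : Type*} [Finite V] (G : SimpleGraph V) :
    ∃ c : V → V → Bool, ∀ x y, c x y ≠ c y x ↔ G.Adj x y := by
  classical
  obtain ⟨n, ⟨e⟩⟩ := Finite.exists_equiv_fin V
  refine ⟨fun x y => decide (G.Adj x y ∧ e x < e y), fun x y => ?_⟩
  by_cases h : G.Adj x y
  · have hne : e x ≠ e y := e.injective.ne h.ne
    rcases lt_or_gt_of_ne hne with hlt | hlt <;> simp [h, h.symm, hlt, hlt.le]
  · have h' : ¬ G.Adj y x := fun k => h k.symm
    simp [h, h']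

theorem IsPartialFun.exists_perm {V : Type} [Fintype V] {p : Set (V × V)} (hp : IsPartialFun p) :
    ∃ π : Equiv.Perm V, ∀ u ∈ p, π u.1 = u.2 := by
  classical
  have hex : ∀ x : V, ∃ y, x ∈ Prod.fst '' p → (x, y) ∈ p := by
    intro x
    by_cases hx : x ∈ Prod.fst '' p
    · obtain ⟨u, hu, rfl⟩ := hx
      exact ⟨u.2, fun _ => hu⟩
    · exact ⟨x, fun h => absurd h hx⟩
  choose f hf using hex
  have hinj : Set.InjOn f (Prod.fst '' p) := fun x hx y hy hxy =>
    (hp _ (hf x hx) _ (hf y hy)).2 hxy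
  obtain ⟨g, hg⟩ := Set.MapsTo.exists_equiv_extend_of_card_eq (t := (Finset.univ : Finset V))
    Finset.card_univ.symm (fun x _ => Finset.mem_coe.2 (Finset.mem_univ (f x))) hinj
  refine ⟨g.trans (Equiv.subtypeUnivEquiv Finset.mem_univ), fun u hu => ?_⟩
  have hm : u.1 ∈ Prod.fst '' p := ⟨u, hu, rfl⟩
  exact (hg _ hm).trans ((hp _ (hf _ hm) _ hu).1 rfl)

/-- Hrushovski's theorem: the class of all finite graphs has EPPA.  For every
finite graph `G` there is a finite graph `H` containing `G` as an induced
subgraph such that every isomorphism between induced subgraphs of `G`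
(a partial bijection preserving adjacency and non-adjacency, represented by
its graph `p`) extends to an automorphism of `H`. -/
theorem graphs_EPPA (V : Type) [Fintype V] (G : SimpleGraph V) :
    ∃ (W : Type) (_ : Fintype W) (H : SimpleGraph W) (i : V ↪ W),
      (∀ x y : V, G.Adj x y ↔ H.Adj (i x) (i y)) ∧
      (∀ p : Set (V × V), IsPartialFun p →
        (∀ u ∈ p, ∀ v ∈ p, G.Adj u.1 v.1 ↔ G.Adj u.2 v.2) →
        ∃ g : Equiv.Perm W,
          (∀ x y : W, H.Adj (g x) (g y) ↔ H.Adj x y) ∧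
          ∀ u ∈ p, g (i u.1) = i u.2) := by
  classical
  obtain ⟨c, hc⟩ := G.exists_valuation
  refine ⟨V × (V → Bool), inferInstance, valuationGraph V,
    ⟨fun x => (x, c x), fun x y h => congrArg Prod.fst h⟩, fun x y => ?_, fun p hp hadj => ?_⟩
  · exact ⟨fun h => ⟨h.ne, (hc x y).2 h⟩, fun h => (hc x y).1 h.2⟩
  obtain ⟨π, hπ⟩ := hp.exists_perm
  let D : V → V → Bool := fun x y => (c (π x) (π y)).xor (c x y)
  let F : V → V → Bool := fun x y =>
    if x ∈ Prod.fst '' p then D x y else if y ∈ Prod.fst '' p then D y x else false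
  have hD : ∀ u ∈ p, ∀ v ∈ p, D u.1 v.1 = D v.1 u.1 := by
    intro u hu v hv
    have h := hadj u hu v hv
    rw [← hc, ← hc, ← hπ u hu, ← hπ v hv] at h
    simp only [D]
    revert h
    generalize c (π u.1) (π v.1) = a, c (π v.1) (π u.1) = b, c u.1 v.1 = d, c v.1 u.1 = e
    revert a b d e
    decide
  have hF : ∀ x y, x ≠ y → F x y = F y x := by
    intro x y _
    by_cases hx : x ∈ Prod.fst '' p <;> by_cases hy : y ∈ Prod.fst '' p <;>
      simp only [F, hx, hy, if_true, if_false]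
    obtain ⟨u, hu, rfl⟩ := hx
    obtain ⟨v, hv, rfl⟩ := hy
    exact hD u hu v hv
  refine ⟨valuationPerm π F, valuationGraph_adj_valuationPerm π hF, fun u hu => ?_⟩
  have hm : u.1 ∈ Prod.fst '' p := ⟨u, hu, rfl⟩
  refine Prod.ext (hπ u hu) (funext fun z => ?_)
  change (c u.1 (π.symm z)).xor (F u.1 (π.symm z)) = c u.2 z
  simp only [F, if_pos hm, D, Equiv.apply_symm_apply, hπ u hu]
  rw [Bool.xor_comm, Bool.xor_assoc, Bool.xor_self, Bool.xor_false]
end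

section
/- Let A be a finite antipodal integer-valued metric space of diameter 3 and let M be the set of unordered pairs of points of A at distance 3. Then there exists an isometric embedding ψ of A into B(M) such that every partial isometry of the image ψ(A) whose domain and range are closed under taking antipodal points of B(M) extends to a surjective self-isometry of B(M); that is, B(M) is an EPPA-witness for ψ(A). -/
/-- A (finite or infinite) integer-valued antipodal metric space of diameter 3,
given by its distance function. -/
def IsAntipodalSpace {A : Type} (d : A → A → ℕ) : Prop :=
  (∀ x : A, d x x = 0) ∧
  (∀ x y : A, d x y = d y x) ∧
  (∀ x y z : A, d x z ≤ d x y + d y z) ∧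
  (∀ x y : A, x ≠ y → d x y = 1 ∨ d x y = 2 ∨ d x y = 3) ∧
  (∀ x y z : A, ¬(d x y = 2 ∧ d y z = 2 ∧ d x z = 3)) ∧
  (∀ x : A, ∃! y : A, d x y = 3)

/-- A partial isometry of `(A, d)`, represented by its graph `p ⊆ A × A`. -/
def IsPartialIsometry {A : Type} (d : A → A → ℕ) (p : Set (A × A)) : Prop :=
  (∀ u ∈ p, ∀ v ∈ p, (u.1 = v.1 ↔ u.2 = v.2)) ∧
  (∀ u ∈ p, ∀ v ∈ p, d u.1 v.1 = d u.2 v.2)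

/-- The domain and the range of the partial map `p` are closed under taking
antipodal points (points at distance 3). -/
def AntipodalClosed {A : Type} (d : A → A → ℕ) (p : Set (A × A)) : Prop :=
  (∀ u ∈ p, ∀ x : A, d u.1 x = 3 → ∃ v ∈ p, v.1 = x) ∧
  (∀ u ∈ p, ∀ y : A, d u.2 y = 3 → ∃ v ∈ p, v.2 = y)

/-- The distance function of the space `B(M)`. -/
def dBM {M : Type} [Fintype M] [DecidableEq M] :
    (M × (M → Bool)) → (M × (M → Bool)) → ℕ := fun u v =>
  if u = v then 0
  else if u.1 = v.1 ∧ v.2 = (fun x => !u.2 x) then 3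
  else if u.2 v.1 = v.2 u.1 then 1 else 2

/-- The set of unordered pairs of points of `(A, d)` at distance 3, encoded as
2-element `Finset`s whose two distinct elements are at distance 3. -/
abbrev MPairs {A : Type} [DecidableEq A] (d : A → A → ℕ) : Type :=
  {s : Finset A // s.card = 2 ∧ ∀ x ∈ s, ∀ y ∈ s, x ≠ y → d x y = 3}

section BM

variable {M : Type} [Fintype M] [DecidableEq M]

theorem dBM_eq_zero_iff {u v : M × (M → Bool)} : dBM u v = 0 ↔ u = v := by
  unfold dBM
  split_ifs <;> simp_all

theorem dBM_eq_three_iff {u v : M × (M → Bool)} :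
    dBM u v = 3 ↔ u.1 = v.1 ∧ v.2 = fun x => !u.2 x := by
  unfold dBM
  split_ifs with h₁ h₂ h₃
  · subst h₁
    simp only [true_and, false_iff]
    intro h
    simpa using congrFun h u.1
  all_goals simp_all

theorem dBM_of_fst_ne {u v : M × (M → Bool)} (h : u.1 ≠ v.1) :
    dBM u v = if u.2 v.1 = v.2 u.1 then 1 else 2 := by
  unfold dBM
  rw [if_neg (fun H => h (congrArg Prod.fst H)), if_neg (fun H => h H.1)]

/-- The self-map of `B(M)` that relabels `M` by `π` and flips coordinates according to `F`. -/
def permFlip (π : Equiv.Perm M) (F : M → M → Bool) (u : M × (M → Bool)) : M × (M → Bool) :=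
  (π u.1, fun f => xor (u.2 (π.symm f)) (F u.1 (π.symm f)))

theorem dBM_permFlip (π : Equiv.Perm M) {F : M → M → Bool} (hF : ∀ e f, F e f = F f e)
    (u v : M × (M → Bool)) : dBM (permFlip π F u) (permFlip π F v) = dBM u v := by
  obtain ⟨e, χ⟩ := u
  obtain ⟨f, χ'⟩ := v
  by_cases h : e = f
  · subst h
    have h₁ : permFlip π F (e, χ) = permFlip π F (e, χ') ↔ (e, χ) = (e, χ') := by
      simp only [permFlip, Prod.mk.injEq, true_and]
      refine ⟨fun h => funext fun x => ?_, fun h => by rw [h]⟩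
      simpa using congrFun h (π x)
    have h₂ : ((fun f => xor (χ' (π.symm f)) (F e (π.symm f))) =
        fun f => !xor (χ (π.symm f)) (F e (π.symm f))) ↔ χ' = fun x => !χ x := by
      refine ⟨fun h => funext fun x => ?_, fun h => by simp [h]⟩
      have := congrFun h (π x)
      simp only [Equiv.symm_apply_apply] at this
      rwa [← Bool.not_xor, Bool.xor_left_inj] at this
    unfold dBM
    rw [if_congr h₁ rfl rfl]
    simp only [permFlip, h₂, true_and, Equiv.symm_apply_apply, Bool.xor_left_inj]
  · rw [dBM_of_fst_ne (u := (e, χ)) (v := (f, χ')) h,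
      dBM_of_fst_ne (by simpa [permFlip] using h)]
    simp [permFlip, hF f e]

theorem permFlip_bijective (π : Equiv.Perm M) {F : M → M → Bool} (hF : ∀ e f, F e f = F f e) :
    Function.Bijective (permFlip π F) :=
  Finite.injective_iff_bijective.1 fun u v h =>
    dBM_eq_zero_iff.1 (by rw [← dBM_permFlip π hF, h, dBM_eq_zero_iff.2 rfl])

theorem exists_perm_extending {α : Type*} {s : Set α} [Finite α] (g : s → α)
    (hg : Function.Injective g) : ∃ π : Equiv.Perm α, ∀ x : s, π x = g x := by
  classical
  have := Fintype.ofFinite α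
  refine ⟨(Equiv.ofInjective g hg).extendSubtype, fun x => ?_⟩
  exact (Equiv.extendSubtype_apply_of_mem _ _ x.2).trans rfl

/-- A partial isometry of `B(M)` whose domain and range contain, over each `e : M`, at most
one antipodal pair, extends to a surjective self-isometry of `B(M)`. -/
theorem exists_isometry_extending {p : Set ((M × (M → Bool)) × (M × (M → Bool)))}
    (hp : IsPartialIsometry dBM p)
    (hdom : ∀ u ∈ p, ∀ v ∈ p, u.1.1 = v.1.1 → u.1 = v.1 ∨ dBM u.1 v.1 = 3)
    (hran : ∀ u ∈ p, ∀ v ∈ p, u.2.1 = v.2.1 → u.2 = v.2 ∨ dBM u.2 v.2 = 3) :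
    ∃ θ : M × (M → Bool) → M × (M → Bool), Function.Bijective θ ∧
      (∀ x y, dBM (θ x) (θ y) = dBM x y) ∧ ∀ u ∈ p, θ u.1 = u.2 := by
  classical
  have hfst : ∀ u ∈ p, ∀ v ∈ p, (u.1.1 = v.1.1 ↔ u.2.1 = v.2.1) := by
    intro u hu v hv
    constructor
    · intro h
      rcases hdom u hu v hv h with h | h
      · rw [(hp.1 u hu v hv).1 h]
      · rw [hp.2 u hu v hv] at h
        exact (dBM_eq_three_iff.1 h).1
    · intro h
      rcases hran u hu v hv h with h | h
      · rw [(hp.1 u hu v hv).2 h]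
      · rw [← hp.2 u hu v hv] at h
        exact (dBM_eq_three_iff.1 h).1
  let s : Set M := {e | ∃ u ∈ p, u.1.1 = e}
  choose U hUp hU using fun e : s => e.2
  obtain ⟨π, hπ⟩ := exists_perm_extending (fun e : s => (U e).2.1) fun e f h =>
    Subtype.ext <| by rw [← hU e, ← hU f, (hfst _ (hUp e) _ (hUp f)).2 h]
  have hπp : ∀ u ∈ p, π u.1.1 = u.2.1 := fun u hu =>
    (hπ ⟨u.1.1, u, hu, rfl⟩).trans <| (hfst _ (hUp _) _ hu).1 (hU _)
  let G : M → M → Bool := fun e f =>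
    if h : e ∈ s then xor ((U ⟨e, h⟩).1.2 f) ((U ⟨e, h⟩).2.2 (π f)) else false
  have hG : ∀ u ∈ p, ∀ f, G u.1.1 f = xor (u.1.2 f) (u.2.2 (π f)) := by
    intro u hu f
    have hs : u.1.1 ∈ s := ⟨u, hu, rfl⟩
    simp only [G, dif_pos hs]
    have hv := hUp ⟨_, hs⟩
    have hvu := hU ⟨_, hs⟩
    generalize U ⟨_, hs⟩ = v at hv hvu ⊢
    rcases hdom v hv u hu hvu with h | h
    · rw [h, (hp.1 v hv u hu).1 h]
    · rw [(dBM_eq_three_iff.1 h).2]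
      rw [hp.2 v hv u hu] at h
      rw [(dBM_eq_three_iff.1 h).2]
      simp
  have hsymm : ∀ e ∈ s, ∀ f ∈ s, G e f = G f e := by
    rintro _ ⟨u, hu, rfl⟩ _ ⟨v, hv, rfl⟩
    by_cases h : u.1.1 = v.1.1
    · rw [h]
    · have := hp.2 u hu v hv
      rw [dBM_of_fst_ne h, dBM_of_fst_ne ((hfst u hu v hv).not.1 h)] at this
      rw [hG u hu, hG v hv, hπp u hu, hπp v hv]
      revert this
      generalize u.1.2 v.1.1 = a, v.1.2 u.1.1 = b, u.2.2 v.2.1 = c, v.2.2 u.2.1 = d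
      revert a b c d
      decide
  let F : M → M → Bool := fun e f => if e ∈ s then G e f else if f ∈ s then G f e else false
  have hF : ∀ e f, F e f = F f e := by
    intro e f
    by_cases he : e ∈ s <;> by_cases hf : f ∈ s <;> simp [F, he, hf]
    exact hsymm e he f hf
  refine ⟨permFlip π F, permFlip_bijective π hF, dBM_permFlip π hF, fun u hu => ?_⟩
  refine Prod.ext (hπp u hu) (funext fun f => ?_)
  have hs : u.1.1 ∈ s := ⟨u, hu, rfl⟩
  simp [permFlip, F, hs, hG u hu]

end BM

namespace IsAntipodalSpace

variable {A : Type} {d : A → A → ℕ}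

theorem eq_of_dist_eq_three (hA : IsAntipodalSpace d) {x y z : A} (hy : d x y = 3)
    (hz : d x z = 3) : y = z :=
  (hA.2.2.2.2.2 x).unique hy hz

theorem dist_of_antipode (hA : IsAntipodalSpace d) {x y y' : A} (hy : d y y' = 3) (hxy : x ≠ y)
    (hxy' : x ≠ y') : d x y = 1 ∧ d x y' = 2 ∨ d x y = 2 ∧ d x y' = 1 := by
  obtain ⟨-, hsymm, htri, hval, h223, -⟩ := id hA
  have h₃ : d x y ≠ 3 := fun h => hxy' (hA.eq_of_dist_eq_three ((hsymm y x).trans h) hy)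
  have h₃' : d x y' ≠ 3 := fun h =>
    hxy (hA.eq_of_dist_eq_three ((hsymm y' x).trans h) ((hsymm y' y).trans hy))
  have := hval x y hxy
  have := hval x y' hxy'
  have := htri y x y'
  have := h223 y x y'
  have := hsymm x y
  omega

theorem exists_embedding [Fintype A] [DecidableEq A] (hA : IsAntipodalSpace d) :
    ∃ ψ : A → MPairs d × (MPairs d → Bool),
      (∀ x y, dBM (ψ x) (ψ y) = d x y) ∧ ∀ x y, (ψ x).1 = (ψ y).1 → x = y ∨ d x y = 3 := by
  obtain ⟨hself, hsymm, -, hval, -, hex⟩ := id hA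
  choose a ha using fun x => (hex x).exists
  have hne : ∀ x, x ≠ a x := fun x h => by
    have := ha x
    rw [← h, hself] at this
    omega
  have haa : ∀ x, a (a x) = x := fun x =>
    hA.eq_of_dist_eq_three (ha (a x)) ((hsymm _ _).trans (ha x))
  let pr : A → MPairs d := fun x => ⟨{x, a x}, Finset.card_pair (hne x), by
    have := hsymm (a x) x
    have := ha x
    simp only [Finset.mem_insert, Finset.mem_singleton]
    rintro y (rfl | rfl) z (rfl | rfl) h <;> first | exact absurd rfl h | omega⟩
  have hpr : ∀ x y, pr x = pr y → x = y ∨ d x y = 3 := by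
    intro x y h
    have hx : x ∈ (pr y).1 := h ▸ Finset.mem_insert_self x {a x}
    rcases Finset.mem_insert.1 hx with h | h
    · exact Or.inl h
    · right
      rw [Finset.mem_singleton.1 h, hsymm]
      exact ha y
  have hpra : ∀ x, pr (a x) = pr x := fun x => Subtype.ext <| by
    simp only [pr, haa]
    exact Finset.pair_comm _ _
  have hprs : ∀ e : MPairs d, ∃ x, pr x = e := by
    rintro ⟨s, hs, hs'⟩
    obtain ⟨x, y, hxy, rfl⟩ := Finset.card_eq_two.1 hs
    refine ⟨x, Subtype.ext ?_⟩
    have : a x = y := hA.eq_of_dist_eq_three (ha x) (hs' x (by simp) y (by simp) hxy)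
    simp only [pr, this]
  choose r hr using hprs
  obtain ⟨k⟩ := Fintype.truncEquivFin (MPairs d)
  have hrx : ∀ x, r (pr x) = x ∨ r (pr x) = a x := fun x =>
    (hpr _ _ (hr (pr x))).imp_right fun h =>
      hA.eq_of_dist_eq_three ((hsymm _ _).trans h) (ha x)
  let χ : A → MPairs d → Bool := fun x f =>
    if k (pr x) ≤ k f then decide (r (pr x) = x) else decide (d (r f) x = 1)
  have hχa : ∀ x f, χ (a x) f = !χ x f := by
    intro x f
    simp only [χ, hpra]
    split_ifs with h
    · rcases hrx x with h | h <;> simp [h, hne x, (hne x).symm]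
    · have hf : f ≠ pr x := fun h' => h (h' ▸ le_rfl)
      have h₁ : r f ≠ x := fun h' => hf (by rw [← hr f, h'])
      have h₂ : r f ≠ a x := fun h' => hf (by rw [← hr f, h', hpra])
      rcases hA.dist_of_antipode (ha x) h₁ h₂ with h | h <;> simp [h.1, h.2]
  have hlt : ∀ x y, k (pr x) < k (pr y) → (χ x (pr y) = χ y (pr x) ↔ d x y = 1) := by
    intro x y h
    have hxy : pr x ≠ pr y := fun h' => h.ne (congrArg k h')
    have h₁ : y ≠ x := fun h' => hxy (by rw [h'])
    have h₂ : y ≠ a x := fun h' => hxy (by rw [h', hpra])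
    simp only [χ, if_pos h.le, if_neg h.not_ge]
    rcases hrx x with hx | hx
    · simp [hx]
    · rw [hx, hsymm (a x), hsymm x]
      rcases hA.dist_of_antipode (ha x) h₁ h₂ with h | h <;> simp [h.1, h.2, (hne x).symm]
  refine ⟨fun x => (pr x, χ x), fun x y => ?_, hpr⟩
  by_cases hxy : x = y
  · rw [hxy, hself, dBM_eq_zero_iff]
  by_cases h₃ : d x y = 3
  · rw [h₃, dBM_eq_three_iff, ← hA.eq_of_dist_eq_three (ha x) h₃]
    exact ⟨(hpra x).symm, funext (hχa x)⟩
  have hprne : pr x ≠ pr y := fun h => (hpr x y h).elim hxy h₃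
  have h₁ : χ x (pr y) = χ y (pr x) ↔ d x y = 1 := by
    rcases lt_or_gt_of_ne (k.injective.ne hprne) with h | h
    · exact hlt x y h
    · rw [eq_comm, hsymm]
      exact hlt y x h
  rw [dBM_of_fst_ne hprne]
  simp only [h₁]
  have := hval x y hxy
  split_ifs <;> omega

end IsAntipodalSpace

/-- For a finite antipodal integer-valued metric space `A` of diameter 3 with
`M` its set of edges of length 3, there is an isometric embedding `ψ` of `A`
into `B(M)` such that `B(M)` is an EPPA-witness for `ψ(A)`: every partial
isometry of `B(M)` living inside the image of `ψ` whose domain and range are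
antipodally closed extends to a surjective self-isometry of `B(M)`. -/
theorem BM_is_EPPA_witness (A : Type) [Fintype A] [DecidableEq A]
    (dA : A → A → ℕ) (hA : IsAntipodalSpace dA) :
    ∃ ψ : A → MPairs dA × (MPairs dA → Bool),
      (∀ x y : A, dBM (ψ x) (ψ y) = dA x y) ∧
      ∀ p : Set ((MPairs dA × (MPairs dA → Bool)) × (MPairs dA × (MPairs dA → Bool))),
        (∀ u ∈ p, u.1 ∈ Set.range ψ ∧ u.2 ∈ Set.range ψ) →
        IsPartialIsometry (dBM (M := MPairs dA)) p →
        AntipodalClosed (dBM (M := MPairs dA)) p →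
        ∃ θ : MPairs dA × (MPairs dA → Bool) → MPairs dA × (MPairs dA → Bool),
          Function.Bijective θ ∧
          (∀ x y, dBM (θ x) (θ y) = dBM x y) ∧
          ∀ u ∈ p, θ u.1 = u.2 := by
  obtain ⟨ψ, hψ, hfst⟩ := hA.exists_embedding
  refine ⟨ψ, hψ, fun p hp hiso _ => exists_isometry_extending hiso ?_ ?_⟩
  · intro u hu v hv h
    obtain ⟨x, hx⟩ := (hp u hu).1
    obtain ⟨y, hy⟩ := (hp v hv).1
    rw [← hx, ← hy] at h ⊢
    exact (hfst x y h).imp (congrArg ψ) (hψ x y).trans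
  · intro u hu v hv h
    obtain ⟨x, hx⟩ := (hp u hu).2
    obtain ⟨y, hy⟩ := (hp v hv).2
    rw [← hx, ← hy] at h ⊢
    exact (hfst x y h).imp (congrArg ψ) (hψ x y).trans
end

section
/- For every finite graph G, the map sending each vertex x of G to the pair {(x,0),(x,1)} is a bijection from the vertex set of G onto M(A(G)) which is an isomorphism from the associated two-graph T(G) onto the associated hypergraph T(A(G)): a 3-element set {x,y,z} of vertices induces an odd number of edges in G if and only if the three pairs {(x,0),(x,1)}, {(y,0),(y,1)}, {(z,0),(z,1)} form a hyperedge of T(A(G)). -/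
open scoped Classical in
/-- Classical indicator of a proposition. -/
noncomputable def indic (P : Prop) : ℕ := if P then 1 else 0

/-- The distance function of the space `A(G)` on `V × Bool`, for a graph `G`. -/
def dAG {V : Type} [DecidableEq V] (G : SimpleGraph V) [DecidableRel G.Adj] :
    (V × Bool) → (V × Bool) → ℕ := fun u v =>
  if u = v then 0
  else if u.1 = v.1 then 3
  else if (G.Adj u.1 v.1 ∧ u.2 = v.2) ∨ (¬G.Adj u.1 v.1 ∧ u.2 ≠ v.2) then 1
  else 2

/-- The unordered pair `{(x, 0), (x, 1)}` of points of `A(G)` over a vertex `x`. -/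
def mp {V : Type} [DecidableEq V] (x : V) : Finset (V × Bool) :=
  {(x, false), (x, true)}

theorem mem_mp {V : Type} [DecidableEq V] {x : V} {u : V × Bool} : u ∈ mp x ↔ u.1 = x := by
  obtain ⟨a, b⟩ := u
  cases b <;> simp [mp]

theorem dAG_eq_three_iff {V : Type} [DecidableEq V] (G : SimpleGraph V) [DecidableRel G.Adj]
    {u v : V × Bool} (h : u ≠ v) : dAG G u v = 3 ↔ u.1 = v.1 := by
  unfold dAG
  split_ifs <;> simp_all

theorem dAG_eq_one_iff {V : Type} [DecidableEq V] (G : SimpleGraph V) [DecidableRel G.Adj]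
    {x y : V} (h : x ≠ y) (i j : Bool) :
    dAG G (x, i) (y, j) = 1 ↔ (G.Adj x y ↔ i = j) := by
  by_cases ha : G.Adj x y <;> by_cases hij : i = j <;> simp [dAG, h, ha, hij]

theorem card_mp {V : Type} [DecidableEq V] (x : V) : (mp x).card = 2 := by
  simp [mp]

theorem exists_mem_mp {V : Type} [DecidableEq V] {x : V} {p : V × Bool → Prop} :
    (∃ u ∈ mp x, p u) ↔ ∃ i, p (x, i) := by
  simp [mp]

theorem odd_indic_add_iff (p q r : Prop) :
    Odd (indic p + indic q + indic r) ↔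
      ∃ i j k : Bool, (p ↔ i = j) ∧ (r ↔ j = k) ∧ (q ↔ i = k) := by
  by_cases hp : p <;> by_cases hq : q <;> by_cases hr : r <;>
    simp [indic, hp, hq, hr] <;> decide

/-- For every finite graph `G`, the map `x ↦ {(x,0),(x,1)}` is a bijection from
the vertex set of `G` onto `M(A(G))` (the set of unordered pairs of points of
`A(G)` at distance 3) which is an isomorphism from the associated two-graph
`T(G)` onto the associated hypergraph `T(A(G))`: a 3-set `{x,y,z}` of vertices
induces an odd number of edges of `G` iff the three corresponding pairs carry
three points that are pairwise at distance 1. -/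
theorem TG_iso_TAG (V : Type) [Fintype V] [DecidableEq V]
    (G : SimpleGraph V) [DecidableRel G.Adj] :
    (∀ x : V, (mp x).card = 2 ∧ ∀ u ∈ mp x, ∀ v ∈ mp x, u ≠ v → dAG G u v = 3) ∧
    Function.Injective (mp (V := V)) ∧
    (∀ s : Finset (V × Bool), s.card = 2 →
      (∀ u ∈ s, ∀ v ∈ s, u ≠ v → dAG G u v = 3) → ∃ x : V, s = mp x) ∧
    (∀ x y z : V, x ≠ y → x ≠ z → y ≠ z →
      (Odd (indic (G.Adj x y) + indic (G.Adj x z) + indic (G.Adj y z)) ↔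
        ∃ u ∈ mp x, ∃ v ∈ mp y, ∃ w ∈ mp z,
          dAG G u v = 1 ∧ dAG G v w = 1 ∧ dAG G u w = 1)) := by
  refine ⟨fun x => ⟨card_mp x, fun u hu v hv huv => ?_⟩, fun x y h => ?_, fun s hs hd => ?_,
    fun x y z hxy hxz hyz => ?_⟩
  · exact (dAG_eq_three_iff G huv).2 ((mem_mp.1 hu).trans (mem_mp.1 hv).symm)
  · have hx : (x, false) ∈ mp y := h ▸ mem_mp.2 rfl
    exact mem_mp.1 hx
  · obtain ⟨u, hu⟩ : s.Nonempty := Finset.card_pos.1 (by omega)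
    refine ⟨u.1, Finset.eq_of_subset_of_card_le (fun v hv => mem_mp.2 ?_) (by rw [hs, card_mp])⟩
    by_cases hvu : v = u
    · rw [hvu]
    · exact (dAG_eq_three_iff G hvu).1 (hd v hv u hu hvu)
  · simp only [exists_mem_mp, dAG_eq_one_iff G hxy, dAG_eq_one_iff G hxz, dAG_eq_one_iff G hyz,
      odd_indic_add_iff]
end

section
/- Let A₁ and A₂ be finite antipodal integer-valued metric spaces of diameter 3 and let β: M(A₁) → M(A₂) be a bijection that is an isomorphism from T(A₁) to T(A₂). Then there exists a distance-preserving bijection α: A₁ → A₂ such that β({x,y}) = {α(x), α(y)} for every pair {x,y} ∈ M(A₁). -/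
/-- `s` is an unordered pair of points of `(A, d)` at distance 3, i.e. an
element of `M(A)`. -/
def IsPair3 {A : Type} (d : A → A → ℕ) (s : Finset A) : Prop :=
  s.card = 2 ∧ ∀ x ∈ s, ∀ y ∈ s, x ≠ y → d x y = 3

/-- Three pairs `a, b, c ∈ M(A)` form a hyperedge of the associated hypergraph
`T(A)`: they carry three points that are pairwise at distance 1. -/
def THyper {A : Type} (d : A → A → ℕ) (a b c : Finset A) : Prop :=
  ∃ x ∈ a, ∃ y ∈ b, ∃ z ∈ c, d x y = 1 ∧ d y z = 1 ∧ d x z = 1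

section

variable {A : Type} {d : A → A → ℕ}

theorem IsPair3.exists_eq [DecidableEq A] {s : Finset A} (hs : IsPair3 d s) {x : A} (hx : x ∈ s) :
    ∃ x', x ≠ x' ∧ d x x' = 3 ∧ s = {x, x'} := by
  obtain ⟨a, b, hab, rfl⟩ := Finset.card_eq_two.mp hs.1
  rcases Finset.mem_insert.mp hx with rfl | hx
  · exact ⟨b, hab, hs.2 _ (by simp) _ (by simp) hab, rfl⟩
  · obtain rfl := Finset.mem_singleton.mp hx
    exact ⟨a, hab.symm, hs.2 _ (by simp) _ (by simp) hab.symm, Finset.pair_comm _ _⟩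

namespace IsAntipodalSpace

theorem antipode_unique (h : IsAntipodalSpace d) {x y z : A} (hy : d x y = 3) (hz : d x z = 3) :
    y = z :=
  (h.2.2.2.2.2 x).unique hy hz

theorem exists_isPair3 [DecidableEq A] (h : IsAntipodalSpace d) (x : A) :
    ∃ s : Finset A, IsPair3 d s ∧ x ∈ s := by
  obtain ⟨h0, hsymm, -, -, -, hex⟩ := h
  obtain ⟨y, hy, -⟩ := hex x
  have hxy : x ≠ y := by
    rintro rfl
    simp [h0] at hy
  have hyx : d y x = 3 := by rw [hsymm, hy]
  exact ⟨{x, y}, ⟨Finset.card_pair hxy, by simp [hy, hyx]⟩, by simp⟩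

theorem pair_unique [DecidableEq A] (h : IsAntipodalSpace d) {s t : Finset A} (hs : IsPair3 d s)
    (ht : IsPair3 d t) {x : A} (hxs : x ∈ s) (hxt : x ∈ t) : s = t := by
  obtain ⟨y, -, hy, rfl⟩ := hs.exists_eq hxs
  obtain ⟨z, -, hz, rfl⟩ := ht.exists_eq hxt
  rw [h.antipode_unique hy hz]

theorem dist_eq_one_or_two [DecidableEq A] (h : IsAntipodalSpace d) {s t : Finset A}
    (hs : IsPair3 d s) (ht : IsPair3 d t) (hst : s ≠ t) {x y : A} (hx : x ∈ s) (hy : y ∈ t) :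
    d x y = 1 ∨ d x y = 2 := by
  have hxy : x ≠ y := by
    rintro rfl
    exact hst (h.pair_unique hs ht hx hy)
  have h3 : d x y ≠ 3 := by
    intro h3
    obtain ⟨z, -, hz, rfl⟩ := hs.exists_eq hx
    obtain rfl := h.antipode_unique h3 hz
    exact hst (h.pair_unique hs ht (by simp) hy)
  have := h.2.2.2.1 x y hxy
  tauto

/-- Replacing a point by its antipode interchanges the distances 1 and 2. -/
theorem dist_antipode_eq_one_iff (h : IsAntipodalSpace d) {x x' y : A} (hx : d x x' = 3)
    (hxy : d x y = 1 ∨ d x y = 2) (hxy' : d x' y = 1 ∨ d x' y = 2) :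
    d x' y = 1 ↔ ¬ d x y = 1 := by
  have htri := h.2.2.1 x y x'
  have h223 := h.2.2.2.2.1 x y x'
  rw [h.2.1 y x'] at htri h223
  omega

/-- A base point `p` determines all distances between points of distinct antipodal pairs from the
hypergraph and the distances to `p`. -/
theorem dist_eq_one_iff [DecidableEq A] (h : IsAntipodalSpace d) {P s t : Finset A}
    (hP : IsPair3 d P) (hs : IsPair3 d s) (ht : IsPair3 d t) (hst : s ≠ t) {p x y : A}
    (hp : p ∈ P) (hx : x ∈ s) (hy : y ∈ t) :
    d x y = 1 ↔ ((d p x ≤ 1 ↔ d p y ≤ 1) ↔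
      (P = s ∨ P = t ∨ THyper d P s t)) := by
  have hsymm := h.2.1
  have key : ∀ {s t : Finset A}, IsPair3 d s → IsPair3 d t → s ≠ t → ∀ {x y : A}, x ∈ s → y ∈ t →
      p ∈ s → (d x y = 1 ↔ (d p x ≤ 1 ↔ d p y ≤ 1)) := by
    intro s t hs ht hst x y hx hy hps
    have hxy := h.dist_eq_one_or_two hs ht hst hx hy
    have hpy := h.dist_eq_one_or_two hs ht hst hps hy
    by_cases hpx : p = x
    · subst hpx
      have := h.1 p
      omega
    · have h3 := hs.2 p hps x hx hpx
      have := h.dist_antipode_eq_one_iff h3 hpy hxy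
      omega
  by_cases hPs : P = s
  · subst hPs
    simpa using key hP ht hst hx hy hp
  by_cases hPt : P = t
  · subst hPt
    have := key hP hs (Ne.symm hst) hy hx hp
    rw [hsymm x y]
    simp only [or_true, true_or, iff_true, this]
    tauto
  obtain ⟨p', -, hp3, rfl⟩ := hP.exists_eq hp
  obtain ⟨x', -, hx3, rfl⟩ := hs.exists_eq hx
  obtain ⟨y', -, hy3, rfl⟩ := ht.exists_eq hy
  have Dps := fun {a b} => h.dist_eq_one_or_two hP hs hPs (x := a) (y := b)
  have Dpt := fun {a b} => h.dist_eq_one_or_two hP ht hPt (x := a) (y := b)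
  have Dst := fun {a b} => h.dist_eq_one_or_two hs ht hst (x := a) (y := b)
  simp only [Finset.mem_insert, Finset.mem_singleton] at Dps Dpt Dst
  have flip : ∀ {a b b'}, d b b' = 3 → (d a b = 1 ∨ d a b = 2) → (d a b' = 1 ∨ d a b' = 2) →
      (d a b' = 1 ↔ ¬ d a b = 1) := by
    intro a b b' hb h1 h2
    rw [hsymm a] at h1 h2 ⊢
    rw [hsymm a b]
    exact h.dist_antipode_eq_one_iff hb h1 h2
  have e1 : d p' x = 1 ↔ ¬ d p x = 1 :=
    h.dist_antipode_eq_one_iff hp3 (Dps (by simp) (by simp)) (Dps (by simp) (by simp))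
  have e2 : d p x' = 1 ↔ ¬ d p x = 1 :=
    flip hx3 (Dps (by simp) (by simp)) (Dps (by simp) (by simp))
  have e3 : d p' x' = 1 ↔ ¬ d p' x = 1 :=
    flip hx3 (Dps (by simp) (by simp)) (Dps (by simp) (by simp))
  have e4 : d p' y = 1 ↔ ¬ d p y = 1 :=
    h.dist_antipode_eq_one_iff hp3 (Dpt (by simp) (by simp)) (Dpt (by simp) (by simp))
  have e5 : d p y' = 1 ↔ ¬ d p y = 1 :=
    flip hy3 (Dpt (by simp) (by simp)) (Dpt (by simp) (by simp))
  have e6 : d p' y' = 1 ↔ ¬ d p' y = 1 :=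
    flip hy3 (Dpt (by simp) (by simp)) (Dpt (by simp) (by simp))
  have e7 : d x' y = 1 ↔ ¬ d x y = 1 :=
    h.dist_antipode_eq_one_iff hx3 (Dst (by simp) (by simp)) (Dst (by simp) (by simp))
  have e8 : d x y' = 1 ↔ ¬ d x y = 1 :=
    flip hy3 (Dst (by simp) (by simp)) (Dst (by simp) (by simp))
  have e9 : d x' y' = 1 ↔ ¬ d x' y = 1 :=
    flip hy3 (Dst (by simp) (by simp)) (Dst (by simp) (by simp))
  have l1 : d p x ≤ 1 ↔ d p x = 1 := by
    have := @Dps p x (by simp) (by simp)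
    omega
  have l2 : d p y ≤ 1 ↔ d p y = 1 := by
    have := @Dpt p y (by simp) (by simp)
    omega
  simp only [THyper, Finset.mem_insert, Finset.mem_singleton, exists_eq_or_imp, exists_eq_left,
    hPs, hPt, e1, e2, e3, e4, e5, e6, e7, e8, e9, l1, l2]
  by_cases c1 : d p x = 1 <;> by_cases c2 : d p y = 1 <;> by_cases c3 : d x y = 1 <;>
    simp [c1, c2, c3]

/-- Exactly one of the two points of an antipodal pair lies in the closed unit ball around `p`. -/
theorem le_one_iff_not_le_one [DecidableEq A] (h : IsAntipodalSpace d) {s : Finset A}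
    (hs : IsPair3 d s) {x y : A} (hx : x ∈ s) (hy : y ∈ s) (hxy : x ≠ y) (p : A) :
    d p x ≤ 1 ↔ ¬ d p y ≤ 1 := by
  have h3 := hs.2 x hx y hy hxy
  obtain ⟨P, hP, hp⟩ := h.exists_isPair3 p
  by_cases hPs : P = s
  · subst hPs
    by_cases hpx : p = x
    · subst hpx
      have := h.1 p
      omega
    · have hpx3 := hs.2 p hp x hx hpx
      rw [h.2.1] at hpx3
      obtain rfl := h.antipode_unique h3 hpx3
      have := h.1 y
      have := h.2.1 x y
      omega
  · have hpx := h.dist_eq_one_or_two hP hs hPs hp hx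
    have hpy := h.dist_eq_one_or_two hP hs hPs hp hy
    have := h.dist_antipode_eq_one_iff h3 (y := p) (by rwa [h.2.1]) (by rwa [h.2.1])
    rw [h.2.1 y, h.2.1 x] at this
    omega

theorem eq_of_le_one_iff [DecidableEq A] (h : IsAntipodalSpace d) {s : Finset A}
    (hs : IsPair3 d s) {x y : A} (hx : x ∈ s) (hy : y ∈ s) {p : A}
    (hxy : d p x ≤ 1 ↔ d p y ≤ 1) : x = y := by
  by_contra hne
  have := h.le_one_iff_not_le_one hs hx hy hne p
  tauto

theorem exists_mem_le_one_iff [DecidableEq A] (h : IsAntipodalSpace d) {s : Finset A}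
    (hs : IsPair3 d s) (p : A) (c : Prop) : ∃ x ∈ s, (d p x ≤ 1 ↔ c) := by
  obtain ⟨x, hx⟩ : s.Nonempty := Finset.card_pos.mp (by rw [hs.1]; norm_num)
  obtain ⟨y, hxy, -, rfl⟩ := hs.exists_eq hx
  have := h.le_one_iff_not_le_one hs hx (by simp) hxy p
  by_cases hc : d p x ≤ 1 ↔ c
  · exact ⟨x, hx, hc⟩
  · exact ⟨y, by simp, by tauto⟩

end IsAntipodalSpace

end

/-- The lifting lemma: for finite antipodal integer-valued metric spaces
`A₁, A₂` of diameter 3, every isomorphism `β : T(A₁) → T(A₂)` of the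
associated two-graphs is induced by a distance-preserving bijection
`α : A₁ → A₂`. -/
theorem twograph_iso_lifts (A₁ A₂ : Type) [Fintype A₁] [Fintype A₂]
    [DecidableEq A₁] [DecidableEq A₂]
    (d₁ : A₁ → A₁ → ℕ) (d₂ : A₂ → A₂ → ℕ)
    (h₁ : IsAntipodalSpace d₁) (h₂ : IsAntipodalSpace d₂)
    (β : {s : Finset A₁ // IsPair3 d₁ s} → {s : Finset A₂ // IsPair3 d₂ s})
    (hβ : Function.Bijective β)
    (hiso : ∀ a b c : {s : Finset A₁ // IsPair3 d₁ s}, a ≠ b → a ≠ c → b ≠ c →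
      (THyper d₁ a.val b.val c.val ↔ THyper d₂ (β a).val (β b).val (β c).val)) :
    ∃ α : A₁ → A₂, Function.Bijective α ∧
      (∀ x y : A₁, d₂ (α x) (α y) = d₁ x y) ∧
      ∀ e : {s : Finset A₁ // IsPair3 d₁ s}, (β e).val = e.val.image α := by
  rcases isEmpty_or_nonempty A₁ with hA | ⟨⟨p⟩⟩
  · have hA₂ : IsEmpty A₂ := by
      refine ⟨fun y => ?_⟩
      obtain ⟨s, hs, -⟩ := h₂.exists_isPair3 y
      obtain ⟨e, -⟩ := hβ.2 ⟨s, hs⟩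
      obtain ⟨x, -⟩ : e.val.Nonempty := Finset.card_pos.mp (by rw [e.2.1]; norm_num)
      exact hA.elim x
    refine ⟨fun x => hA.elim x, ⟨fun x => hA.elim x, fun y => hA₂.elim y⟩, fun x => hA.elim x,
      fun e => ?_⟩
    ext y
    exact hA₂.elim y
  choose S hS hmem using h₁.exists_isPair3
  let B : A₁ → {s : Finset A₁ // IsPair3 d₁ s} := fun x => ⟨S x, hS x⟩
  have hB : ∀ (e : {s : Finset A₁ // IsPair3 d₁ s}) (x : A₁), x ∈ e.val → B x = e :=
    fun e x hx => Subtype.ext (h₁.pair_unique (hS x) e.2 (hmem x) hx)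
  obtain ⟨q, hq⟩ : (β (B p)).val.Nonempty :=
    Finset.card_pos.mp (by rw [(β (B p)).2.1]; norm_num)
  choose α hα hαp using fun x : A₁ =>
    h₂.exists_mem_le_one_iff (β (B x)).2 q (d₁ p x ≤ 1)
  have hdist : ∀ x y : A₁, d₂ (α x) (α y) = d₁ x y := by
    intro x y
    by_cases hxy : x = y
    · rw [hxy, h₁.1, h₂.1]
    by_cases hBxy : B x = B y
    · have hy : y ∈ (B x).val := hBxy ▸ hmem y
      have hαy : α y ∈ (β (B x)).val := hBxy ▸ hα y
      rw [(B x).2.2 x (hmem x) y hy hxy]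
      refine (β (B x)).2.2 _ (hα x) _ hαy fun hne => hxy ?_
      refine h₁.eq_of_le_one_iff (p := p) (B x).2 (hmem x) hy ?_
      rw [← hαp, ← hαp, hne]
    · have hne₁ : (B x).val ≠ (B y).val := fun he => hBxy (Subtype.ext he)
      have hne₂ : (β (B x)).val ≠ (β (B y)).val := fun he => hBxy (hβ.1 (Subtype.ext he))
      have i₁ := h₁.dist_eq_one_iff (B p).2 (B x).2 (B y).2 hne₁ (hmem p) (hmem x) (hmem y)
      have i₂ := h₂.dist_eq_one_iff (β (B p)).2 (β (B x)).2 (β (B y)).2 hne₂ hq (hα x) (hα y)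
      have hval : ∀ u v, (β (B u)).val = (β (B v)).val ↔ (B u).val = (B v).val := fun u v =>
        Subtype.ext_iff.symm.trans (hβ.1.eq_iff.trans Subtype.ext_iff)
      have hT : ((β (B p)).val = (β (B x)).val ∨ (β (B p)).val = (β (B y)).val ∨
          THyper d₂ (β (B p)).val (β (B x)).val (β (B y)).val) ↔
          ((B p).val = (B x).val ∨ (B p).val = (B y).val ∨
            THyper d₁ (B p).val (B x).val (B y).val) := by
        rw [hval, hval]
        by_cases hpx : (B p).val = (B x).val
        · exact iff_of_true (Or.inl hpx) (Or.inl hpx)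
        by_cases hpy : (B p).val = (B y).val
        · exact iff_of_true (Or.inr (Or.inl hpy)) (Or.inr (Or.inl hpy))
        rw [hiso (B p) (B x) (B y) (Subtype.coe_ne_coe.mp hpx) (Subtype.coe_ne_coe.mp hpy) hBxy]
      have h1 : d₂ (α x) (α y) = 1 ↔ d₁ x y = 1 := by
        rw [i₁, i₂, hαp, hαp, hT]
      have o₁ := h₁.dist_eq_one_or_two (B x).2 (B y).2 hne₁ (hmem x) (hmem y)
      have o₂ := h₂.dist_eq_one_or_two (β (B x)).2 (β (B y)).2 hne₂ (hα x) (hα y)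
      omega
  have hinj : Function.Injective α := by
    intro x y hxy
    by_contra hne
    have h0 := hdist x y
    rw [hxy, h₂.1] at h0
    have := h₁.2.2.2.1 x y hne
    omega
  refine ⟨α, ⟨hinj, fun y => ?_⟩, hdist, fun e => ?_⟩
  · obtain ⟨s, hs, hy⟩ := h₂.exists_isPair3 y
    obtain ⟨e, he⟩ := hβ.2 ⟨s, hs⟩
    obtain ⟨x, hx, hxp⟩ := h₁.exists_mem_le_one_iff e.2 p (d₂ q y ≤ 1)
    have hαx := hα x
    rw [hB e x hx, he] at hαx
    exact ⟨x, h₂.eq_of_le_one_iff (p := q) hs hαx hy ((hαp x).trans hxp)⟩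
  · symm
    apply Finset.eq_of_subset_of_card_le
    · intro y hy
      obtain ⟨x, hx, rfl⟩ := Finset.mem_image.mp hy
      exact hB e x hx ▸ hα x
    · rw [Finset.card_image_of_injective _ hinj, (β e).2.1, e.2.1]
end

section
/- The class of finite two-graphs has the amalgamation property: for all finite two-graphs A, B₁, B₂ and embeddings α₁: A → B₁ and α₂: A → B₂, there exist a finite two-graph C and embeddings β₁: B₁ → C and β₂: B₂ → C such that β₁ ∘ α₁ = β₂ ∘ α₂. -/
/-- The three-element set `{a, b, c}` (as a `Finset`), defined classically. -/
noncomputable def tri {V : Type} (a b c : V) : Finset V :=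
  letI := Classical.decEq V
  {a, b, c}

/-- A two-graph: a set of 3-element hyperedges such that every four distinct
vertices carry an even number of hyperedges. -/
def IsTwoGraph {V : Type} (T : Finset (Finset V)) : Prop :=
  (∀ t ∈ T, t.card = 3) ∧
  ∀ a b c d : V, a ≠ b → a ≠ c → a ≠ d → b ≠ c → b ≠ d → c ≠ d →
    Even (indic (tri a b c ∈ T) + indic (tri a b d ∈ T) +
      indic (tri a c d ∈ T) + indic (tri b c d ∈ T))

/-- An embedding of two-graphs: an injection of vertex sets under which a
triple of distinct vertices is a hyperedge iff its image is. -/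
def IsTGEmbedding {V W : Type} (TV : Finset (Finset V))
    (TW : Finset (Finset W)) (i : V ↪ W) : Prop :=
  ∀ a b c : V, a ≠ b → a ≠ c → b ≠ c →
    (tri a b c ∈ TV ↔ tri (i a) (i b) (i c) ∈ TW)

open scoped Classical in
theorem mem_tri {V : Type} {a b c x : V} : x ∈ tri a b c ↔ x = a ∨ x = b ∨ x = c := by
  simp [tri]

theorem card_tri {V : Type} {a b c : V} :
    (tri a b c).card = 3 ↔ a ≠ b ∧ a ≠ c ∧ b ≠ c := by
  classical
  have h : tri a b c = {a, b, c} := by ext x; simp [mem_tri]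
  rw [h, Finset.card_eq_three]
  constructor
  · rintro ⟨x, y, z, hxy, hxz, hyz, h⟩
    have hc : ({a, b, c} : Finset V).card = 3 := by
      rw [h]; exact Finset.card_eq_three.2 ⟨x, y, z, hxy, hxz, hyz, rfl⟩
    refine ⟨?_, ?_, ?_⟩ <;> rintro rfl
    · have := Finset.card_le_two (a := a) (b := c); simp_all
    · have := Finset.card_le_two (a := b) (b := a); simp_all
    · have := Finset.card_le_two (a := a) (b := b); simp_all
  · rintro ⟨hab, hac, hbc⟩
    exact ⟨a, b, c, hab, hac, hbc, rfl⟩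

theorem tri_swap_left {V : Type} (a b c : V) : tri a b c = tri b a c := by
  ext x; simp only [mem_tri]; tauto

theorem tri_swap_right {V : Type} (a b c : V) : tri a b c = tri a c b := by
  ext x; simp only [mem_tri]; tauto

theorem even_indic_add_iff (p q r s : Prop) :
    Even (indic p + indic q + indic r + indic s) ↔ (s ↔ (p ↔ (q ↔ r))) := by
  by_cases hp : p <;> by_cases hq : q <;> by_cases hr : r <;> by_cases hs : s <;>
    simp [indic, hp, hq, hr, hs, Nat.even_iff]

/-- Among the pairs from `a`, `b`, `c`, an odd number are edges of `G`. -/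
def SimpleGraph.OddTriple {V : Type} (G : SimpleGraph V) (a b c : V) : Prop :=
  G.Adj a b ↔ (G.Adj a c ↔ G.Adj b c)

/-- The graph `G` belongs to the switching class of the two-graph `T`. -/
def SimpleGraph.Induces {V : Type} (G : SimpleGraph V) (T : Finset (Finset V)) : Prop :=
  ∀ a b c, a ≠ b → a ≠ c → b ≠ c → (tri a b c ∈ T ↔ G.OddTriple a b c)

theorem SimpleGraph.OddTriple.of_tri_eq {V : Type} {G : SimpleGraph V} {a b c x y z : V}
    (hxy : x ≠ y) (hxz : x ≠ z) (hyz : y ≠ z) (h : tri a b c = tri x y z)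
    (hG : G.OddTriple x y z) : G.OddTriple a b c := by
  have habc := card_tri.1 (h ▸ card_tri.2 ⟨hxy, hxz, hyz⟩)
  have ha : a = x ∨ a = y ∨ a = z := by rw [← mem_tri, ← h, mem_tri]; simp
  have hb : b = x ∨ b = y ∨ b = z := by rw [← mem_tri, ← h, mem_tri]; simp
  have hc : c = x ∨ c = y ∨ c = z := by rw [← mem_tri, ← h, mem_tri]; simp
  have h1 := G.adj_comm x y
  have h2 := G.adj_comm x z
  have h3 := G.adj_comm y z
  unfold SimpleGraph.OddTriple at *
  rcases ha with rfl | rfl | rfl <;> rcases hb with rfl | rfl | rfl <;>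
    rcases hc with rfl | rfl | rfl <;> tauto

/-- Every graph on a finite vertex set gives rise to a two-graph. -/
theorem SimpleGraph.exists_isTwoGraph_induces {V : Type} [Fintype V] (G : SimpleGraph V) :
    ∃ T : Finset (Finset V), IsTwoGraph T ∧ G.Induces T := by
  classical
  let T : Finset (Finset V) := {t | ∃ a b c, a ≠ b ∧ a ≠ c ∧ b ≠ c ∧ t = tri a b c ∧
    G.OddTriple a b c}
  have hT : G.Induces T := by
    intro a b c hab hac hbc
    simp only [T, Finset.mem_filter, Finset.mem_univ, true_and]
    constructor
    · rintro ⟨x, y, z, hxy, hxz, hyz, h, hG⟩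
      exact hG.of_tri_eq hxy hxz hyz h
    · exact fun h => ⟨a, b, c, hab, hac, hbc, rfl, h⟩
  refine ⟨T, ⟨?_, ?_⟩, hT⟩
  · intro t ht
    obtain ⟨a, b, c, hab, hac, hbc, rfl, -⟩ := (Finset.mem_filter.1 ht).2
    exact card_tri.2 ⟨hab, hac, hbc⟩
  · intro a b c d hab hac had hbc hbd hcd
    rw [even_indic_add_iff, hT a b c hab hac hbc, hT a b d hab had hbd, hT a c d hac had hcd,
      hT b c d hbc hbd hcd]
    unfold SimpleGraph.OddTriple
    grind

/-- The graph in the switching class of `T` in which `v` is isolated. -/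
def IsTwoGraph.descendant {V : Type} {T : Finset (Finset V)} (hT : IsTwoGraph T) (v : V) :
    SimpleGraph V where
  Adj x y := tri v x y ∈ T
  symm := ⟨fun x y h => tri_swap_right v x y ▸ h⟩
  loopless := ⟨fun _ h => (card_tri.1 (hT.1 _ h)).2.2 rfl⟩

theorem IsTwoGraph.descendant_induces {V : Type} {T : Finset (Finset V)} (hT : IsTwoGraph T)
    (v : V) : (hT.descendant v).Induces T := by
  intro a b c hab hac hbc
  have hl : ∀ x, tri v v x ∉ T := fun x h => (card_tri.1 (hT.1 _ h)).1 rfl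
  have hr : ∀ x, tri v x v ∉ T := fun x h => (card_tri.1 (hT.1 _ h)).2.1 rfl
  change _ ↔ (tri v a b ∈ T ↔ (tri v a c ∈ T ↔ tri v b c ∈ T))
  by_cases ha : v = a
  · subst ha; simp [hl]
  by_cases hb : v = b
  · subst hb; simp [hl, hr, tri_swap_left a v c]
  by_cases hc : v = c
  · subst hc; simp [hr, tri_swap_right a b v, tri_swap_left a v b]
  exact (even_indic_add_iff _ _ _ _).1 (hT.2 v a b c ha hb hc hab hac hbc)

theorem IsTwoGraph.exists_induces {V : Type} {T : Finset (Finset V)} (hT : IsTwoGraph T) :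
    ∃ G : SimpleGraph V, G.Induces T := by
  rcases isEmpty_or_nonempty V with _ | ⟨⟨v⟩⟩
  · exact ⟨⊥, fun a => isEmptyElim a⟩
  · exact ⟨_, hT.descendant_induces v⟩

/-- Two embeddings of a common two-graph admit inducing graphs that restrict to the same graph. -/
theorem exists_induces_comap_eq {VA VB1 VB2 : Type} {TA : Finset (Finset VA)}
    {TB1 : Finset (Finset VB1)} {TB2 : Finset (Finset VB2)}
    (hB1 : IsTwoGraph TB1) (hB2 : IsTwoGraph TB2) {α1 : VA ↪ VB1} {α2 : VA ↪ VB2}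
    (hα1 : IsTGEmbedding TA TB1 α1) (hα2 : IsTGEmbedding TA TB2 α2) :
    ∃ (G1 : SimpleGraph VB1) (G2 : SimpleGraph VB2), G1.Induces TB1 ∧ G2.Induces TB2 ∧
      ∀ x y, G1.Adj (α1 x) (α1 y) ↔ G2.Adj (α2 x) (α2 y) := by
  rcases isEmpty_or_nonempty VA with _ | ⟨⟨v⟩⟩
  · obtain ⟨G1, h1⟩ := hB1.exists_induces
    obtain ⟨G2, h2⟩ := hB2.exists_induces
    exact ⟨G1, G2, h1, h2, fun x => isEmptyElim x⟩
  · refine ⟨_, _, hB1.descendant_induces (α1 v), hB2.descendant_induces (α2 v), fun x y => ?_⟩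
    change tri _ _ _ ∈ TB1 ↔ tri _ _ _ ∈ TB2
    by_cases h : v ≠ x ∧ v ≠ y ∧ x ≠ y
    · rw [← hα1 v x y h.1 h.2.1 h.2.2, hα2 v x y h.1 h.2.1 h.2.2]
    · refine iff_of_false (fun h' => h ?_) (fun h' => h ?_)
      · simpa using card_tri.1 (hB1.1 _ h')
      · simpa using card_tri.1 (hB2.1 _ h')

/-- Finite sets have strong amalgamation. -/
theorem exists_amalgam_embedding {A B1 B2 : Type} [Fintype B1] [Fintype B2]
    (α1 : A ↪ B1) (α2 : A ↪ B2) :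
    ∃ (C : Type) (_ : Fintype C) (β1 : B1 ↪ C) (β2 : B2 ↪ C),
      (∀ x, β1 (α1 x) = β2 (α2 x)) ∧
      ∀ x y, β1 x = β2 y → ∃ a, α1 a = x ∧ α2 a = y := by
  classical
  let f : B2 → B1 ⊕ B2 := fun y => if h : ∃ a, α2 a = y then .inl (α1 h.choose) else .inr y
  have hf : ∀ a, f (α2 a) = .inl (α1 a) := fun a => by
    have h : ∃ a', α2 a' = α2 a := ⟨a, rfl⟩
    simp only [f, dif_pos h]
    rw [α2.injective h.choose_spec]
  have hf' : ∀ y, (¬ ∃ a, α2 a = y) → f y = .inr y := fun y h => by simp only [f, dif_neg h]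
  have hinj : f.Injective := by
    intro x y hxy
    by_cases hx : ∃ a, α2 a = x <;> by_cases hy : ∃ a, α2 a = y
    · obtain ⟨a, rfl⟩ := hx
      obtain ⟨b, rfl⟩ := hy
      simpa [hf] using hxy
    · obtain ⟨a, rfl⟩ := hx
      simp [hf, hf' y hy] at hxy
    · obtain ⟨b, rfl⟩ := hy
      simp [hf, hf' x hx] at hxy
    · simpa [hf' x hx, hf' y hy] using hxy
  refine ⟨B1 ⊕ B2, inferInstance, .inl, ⟨f, hinj⟩, fun a => (hf a).symm, fun x y hxy => ?_⟩
  change Sum.inl x = f y at hxy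
  by_cases hy : ∃ a, α2 a = y
  · obtain ⟨a, rfl⟩ := hy
    rw [hf] at hxy
    exact ⟨a, (Sum.inl_injective hxy).symm, rfl⟩
  · simp [hf' y hy] at hxy

theorem SimpleGraph.Induces.isTGEmbedding {V W : Type} {G : SimpleGraph V} {H : SimpleGraph W}
    {S : Finset (Finset V)} {T : Finset (Finset W)} (hG : G.Induces S) (hH : H.Induces T)
    (i : G ↪g H) : IsTGEmbedding S T i.toEmbedding := by
  intro a b c hab hac hbc
  have h := hH _ _ _ (i.injective.ne hab) (i.injective.ne hac) (i.injective.ne hbc)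
  rw [SimpleGraph.OddTriple, i.map_adj_iff, i.map_adj_iff, i.map_adj_iff] at h
  exact (hG a b c hab hac hbc).trans h.symm

/-- The class of finite two-graphs has the amalgamation property. -/
theorem twographs_amalgamation
    (VA VB1 VB2 : Type) [Fintype VA] [Fintype VB1] [Fintype VB2]
    (TA : Finset (Finset VA)) (TB1 : Finset (Finset VB1))
    (TB2 : Finset (Finset VB2))
    (hA : IsTwoGraph TA) (hB1 : IsTwoGraph TB1) (hB2 : IsTwoGraph TB2)
    (α1 : VA ↪ VB1) (α2 : VA ↪ VB2)
    (hα1 : IsTGEmbedding TA TB1 α1) (hα2 : IsTGEmbedding TA TB2 α2) :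
    ∃ (VC : Type) (_ : Fintype VC) (TC : Finset (Finset VC))
      (β1 : VB1 ↪ VC) (β2 : VB2 ↪ VC),
      IsTwoGraph TC ∧ IsTGEmbedding TB1 TC β1 ∧ IsTGEmbedding TB2 TC β2 ∧
      ∀ x : VA, β1 (α1 x) = β2 (α2 x) := by
  obtain ⟨G1, G2, hG1, hG2, hG⟩ := exists_induces_comap_eq hB1 hB2 hα1 hα2
  obtain ⟨VC, hVC, β1, β2, hβ, hβ'⟩ := exists_amalgam_embedding α1 α2
  obtain ⟨TC, hTC, hind⟩ := (G1.map β1 ⊔ G2.map β2).exists_isTwoGraph_induces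
  have h1 : ∀ {x y}, (G1.map β1 ⊔ G2.map β2).Adj (β1 x) (β1 y) ↔ G1.Adj x y := by
    intro x y
    rw [SimpleGraph.sup_adj, SimpleGraph.map_adj_apply, or_iff_left_iff_imp,
      SimpleGraph.map_adj]
    rintro ⟨u, v, h, hu, hv⟩
    obtain ⟨a, rfl, rfl⟩ := hβ' _ _ hu.symm
    obtain ⟨b, rfl, rfl⟩ := hβ' _ _ hv.symm
    exact (hG a b).2 h
  have h2 : ∀ {x y}, (G1.map β1 ⊔ G2.map β2).Adj (β2 x) (β2 y) ↔ G2.Adj x y := by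
    intro x y
    rw [SimpleGraph.sup_adj, SimpleGraph.map_adj_apply, or_iff_right_iff_imp,
      SimpleGraph.map_adj]
    rintro ⟨u, v, h, hu, hv⟩
    obtain ⟨a, rfl, rfl⟩ := hβ' _ _ hu
    obtain ⟨b, rfl, rfl⟩ := hβ' _ _ hv
    exact (hG a b).1 h
  exact ⟨VC, hVC, TC, β1, β2, hTC, hG1.isTGEmbedding hind ⟨β1, h1⟩,
    hG2.isTGEmbedding hind ⟨β2, h2⟩, hβ⟩
end
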